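/- For every λ > 0 and every real z with 0 < z < 1/(λ + 2), the generating series of the λ-weighted Motzkin counts converges and satisfies Σ_{n=0}^∞ M_n(λ) z^n = (1 − λz − √((1 − λz)² − 4z²)) / (2z²), where √ is the real square root. -/

import Mathlib

open MeasureTheory

-- A Motzkin path, encoded as a word over `Fin 3`
-- (`0` = up-step `a`, `1` = down-step `b`, `2` = level-step `c`):
-- every prefix has at least as many up-steps as down-steps, and the full word
-- has equally many up-steps and down-steps.
def IsMotzkin (u : List (Fin 3)) : Prop :=
  (∀ j : ℕ, (u.take j).count 1 ≤ (u.take j).count 0) ∧ u.count 0 = u.count 1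

-- A Riordan path: a Motzkin path with no level-step at height `0`.
def IsRiordan (u : List (Fin 3)) : Prop :=
  IsMotzkin u ∧
    ∀ j : Fin u.length, u.get j = 2 → (u.take j).count 1 < (u.take j).count 0

-- `bOne lam n = b_{1,n}(λ) = Σ_{u ∈ 𝓡(n)} λ^{|u|_c}`, the λ-weighted count of
-- Riordan paths of size `n` (words of length `n` encoded by functions `Fin n → Fin 3`).
open Classical in
noncomputable def bOne (lam : ℝ) (n : ℕ) : ℝ :=
  ∑ f : Fin n → Fin 3,
    if IsRiordan (List.ofFn f) then lam ^ ((List.ofFn f).count 2) else 0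

-- `mOne lam n = M_n(λ) = Σ_{u ∈ 𝓜(n)} λ^{|u|_c}`, the λ-weighted count of
-- Motzkin paths of size `n`.
open Classical in
noncomputable def mOne (lam : ℝ) (n : ℕ) : ℝ :=
  ∑ f : Fin n → Fin 3,
    if IsMotzkin (List.ofFn f) then lam ^ ((List.ofFn f).count 2) else 0

/-- The words that, started at height `h`, never go below height `0` and end at height `0`. -/
def IsMotzkinFrom (h : ℕ) (u : List (Fin 3)) : Prop :=
  (∀ j : ℕ, (u.take j).count 1 ≤ h + (u.take j).count 0) ∧ h + u.count 0 = u.count 1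

lemma isMotzkinFrom_zero_iff (u : List (Fin 3)) : IsMotzkinFrom 0 u ↔ IsMotzkin u := by
  simp [IsMotzkinFrom, IsMotzkin]

lemma isMotzkinFrom_nil_iff (h : ℕ) : IsMotzkinFrom h [] ↔ h = 0 := by
  simp [IsMotzkinFrom]

lemma forall_take_cons_iff {α : Type*} (p : List α → Prop) (a : α) (u : List α) :
    (∀ j : ℕ, p ((a :: u).take j)) ↔ p [] ∧ ∀ j : ℕ, p (a :: u.take j) :=
  ⟨fun H => ⟨H 0, fun j => H (j + 1)⟩, fun H j => by cases j with
    | zero => exact H.1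
    | succ j => exact H.2 j⟩

lemma isMotzkinFrom_up_iff (h : ℕ) (u : List (Fin 3)) :
    IsMotzkinFrom h (0 :: u) ↔ IsMotzkinFrom (h + 1) u := by
  unfold IsMotzkinFrom
  rw [forall_take_cons_iff (fun v => v.count 1 ≤ h + v.count 0)]
  simp [add_assoc, add_comm]

lemma not_isMotzkinFrom_zero_down (u : List (Fin 3)) : ¬ IsMotzkinFrom 0 (1 :: u) := by
  intro H
  simpa using H.1 1

lemma isMotzkinFrom_succ_down_iff (h : ℕ) (u : List (Fin 3)) :
    IsMotzkinFrom (h + 1) (1 :: u) ↔ IsMotzkinFrom h u := by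
  unfold IsMotzkinFrom
  rw [forall_take_cons_iff (fun v => v.count 1 ≤ h + 1 + v.count 0)]
  simp [add_right_comm h 1]

lemma isMotzkinFrom_level_iff (h : ℕ) (u : List (Fin 3)) :
    IsMotzkinFrom h (2 :: u) ↔ IsMotzkinFrom h u := by
  unfold IsMotzkinFrom
  rw [forall_take_cons_iff (fun v => v.count 1 ≤ h + v.count 0)]
  simp

open Classical in
/-- The weighted count of the words of size `n` satisfying `IsMotzkinFrom h`. -/
noncomputable def motzkinFromCount (lam : ℝ) (h n : ℕ) : ℝ :=
  ∑ f : Fin n → Fin 3,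
    if IsMotzkinFrom h (List.ofFn f) then lam ^ ((List.ofFn f).count 2) else 0

lemma motzkinFromCount_zero_left (lam : ℝ) (n : ℕ) :
    motzkinFromCount lam 0 n = mOne lam n := by
  classical
  unfold motzkinFromCount mOne
  exact Finset.sum_congr rfl fun f _ => if_congr (isMotzkinFrom_zero_iff _) rfl rfl

lemma motzkinFromCount_nonneg {lam : ℝ} (hlam : 0 ≤ lam) (h n : ℕ) :
    0 ≤ motzkinFromCount lam h n :=
  Finset.sum_nonneg fun f _ => by split_ifs <;> positivity

lemma motzkinFromCount_zero_right (lam : ℝ) (h : ℕ) :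
    motzkinFromCount lam h 0 = if h = 0 then 1 else 0 := by
  simp [motzkinFromCount, isMotzkinFrom_nil_iff]

lemma sum_ofFn_succ (F : List (Fin 3) → ℝ) (n : ℕ) :
    ∑ f : Fin (n + 1) → Fin 3, F (List.ofFn f) =
      ∑ f : Fin n → Fin 3, F (0 :: List.ofFn f) + ∑ f : Fin n → Fin 3, F (1 :: List.ofFn f) +
        ∑ f : Fin n → Fin 3, F (2 :: List.ofFn f) := by
  rw [← (Fin.consEquiv fun _ : Fin (n + 1) => Fin 3).sum_comp, Fintype.sum_prod_type,
    Fin.sum_univ_three]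
  simp [Fin.consEquiv]

lemma motzkinFromCount_zero_succ (lam : ℝ) (n : ℕ) :
    motzkinFromCount lam 0 (n + 1) =
      motzkinFromCount lam 1 n + lam * motzkinFromCount lam 0 n := by
  classical
  unfold motzkinFromCount
  rw [sum_ofFn_succ (fun u => if IsMotzkinFrom 0 u then lam ^ u.count 2 else 0)]
  simp [isMotzkinFrom_up_iff, not_isMotzkinFrom_zero_down, isMotzkinFrom_level_iff,
    Finset.mul_sum, pow_succ']

lemma motzkinFromCount_succ_succ (lam : ℝ) (h n : ℕ) :
    motzkinFromCount lam (h + 1) (n + 1) =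
      motzkinFromCount lam (h + 2) n + motzkinFromCount lam h n +
        lam * motzkinFromCount lam (h + 1) n := by
  classical
  unfold motzkinFromCount
  rw [sum_ofFn_succ (fun u => if IsMotzkinFrom (h + 1) u then lam ^ u.count 2 else 0)]
  simp [isMotzkinFrom_up_iff, isMotzkinFrom_succ_down_iff, isMotzkinFrom_level_iff,
    Finset.mul_sum, pow_succ']

/-- If `M` solves the quadratic functional equation, then the `h`-th generating series is
`M * (z * M) ^ h`, with a geometric bound on the error of the partial sums, uniform in `h`. -/
lemma abs_sub_sum_motzkinFromCount_le {lam z M : ℝ} (hlam : 0 ≤ lam) (hz : 0 ≤ z) (hM : 0 ≤ M)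
    (hzM : z * M ≤ 1) (hquad : M = 1 + lam * z * M + z ^ 2 * M ^ 2) (N h : ℕ) :
    |M * (z * M) ^ h - ∑ n ∈ Finset.range N, motzkinFromCount lam h n * z ^ n| ≤
      M * (z * (lam + 2)) ^ N := by
  induction N generalizing h with
  | zero =>
    have : (z * M) ^ h ≤ 1 := pow_le_one₀ (by positivity) hzM
    simpa [abs_of_nonneg, hM, hz] using mul_le_of_le_one_right hM this
  | succ N ih =>
    cases h with
    | zero =>
      have hB : 0 ≤ M * (z * (lam + 2)) ^ N := by positivity
      have key : M * (z * M) ^ 0 -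
            ∑ n ∈ Finset.range (N + 1), motzkinFromCount lam 0 n * z ^ n =
          z * ((M * (z * M) ^ 1 - ∑ n ∈ Finset.range N, motzkinFromCount lam 1 n * z ^ n) +
            lam * (M * (z * M) ^ 0 -
              ∑ n ∈ Finset.range N, motzkinFromCount lam 0 n * z ^ n)) := by
        have : ∑ n ∈ Finset.range N, motzkinFromCount lam 0 (n + 1) * z ^ (n + 1) =
            z * (∑ n ∈ Finset.range N, motzkinFromCount lam 1 n * z ^ n +
              lam * ∑ n ∈ Finset.range N, motzkinFromCount lam 0 n * z ^ n) := by
          simp only [Finset.mul_sum, ← Finset.sum_add_distrib]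
          exact Finset.sum_congr rfl fun n _ => by rw [motzkinFromCount_zero_succ]; ring
        rw [Finset.sum_range_succ', this, motzkinFromCount_zero_right, if_pos rfl]
        linear_combination hquad
      rw [key, abs_mul, abs_of_nonneg hz]
      calc _ ≤ z * (M * (z * (lam + 2)) ^ N + lam * (M * (z * (lam + 2)) ^ N)) := by
            gcongr
            refine (abs_add_le _ _).trans ?_
            rw [abs_mul, abs_of_nonneg hlam]
            gcongr
            · exact ih 1
            · exact ih 0
        _ ≤ _ := by rw [pow_succ]; nlinarith [mul_nonneg hz hB]
    | succ h =>
      have key : M * (z * M) ^ (h + 1) -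
            ∑ n ∈ Finset.range (N + 1), motzkinFromCount lam (h + 1) n * z ^ n =
          z * ((M * (z * M) ^ (h + 2) -
              ∑ n ∈ Finset.range N, motzkinFromCount lam (h + 2) n * z ^ n) +
            (M * (z * M) ^ h - ∑ n ∈ Finset.range N, motzkinFromCount lam h n * z ^ n) +
            lam * (M * (z * M) ^ (h + 1) -
              ∑ n ∈ Finset.range N, motzkinFromCount lam (h + 1) n * z ^ n)) := by
        have : ∑ n ∈ Finset.range N, motzkinFromCount lam (h + 1) (n + 1) * z ^ (n + 1) =
            z * (∑ n ∈ Finset.range N, motzkinFromCount lam (h + 2) n * z ^ n +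
              ∑ n ∈ Finset.range N, motzkinFromCount lam h n * z ^ n +
              lam * ∑ n ∈ Finset.range N, motzkinFromCount lam (h + 1) n * z ^ n) := by
          simp only [Finset.mul_sum, ← Finset.sum_add_distrib]
          exact Finset.sum_congr rfl fun n _ => by rw [motzkinFromCount_succ_succ]; ring
        rw [Finset.sum_range_succ', this, motzkinFromCount_zero_right, if_neg h.succ_ne_zero]
        linear_combination (M * (z * M) ^ h * z) * hquad
      rw [key, abs_mul, abs_of_nonneg hz]
      calc _ ≤ z * (M * (z * (lam + 2)) ^ N + M * (z * (lam + 2)) ^ N +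
              lam * (M * (z * (lam + 2)) ^ N)) := by
            gcongr
            refine (abs_add_three _ _ _).trans ?_
            rw [abs_mul, abs_of_nonneg hlam]
            gcongr
            · exact ih (h + 2)
            · exact ih h
            · exact ih (h + 1)
        _ = _ := by ring

lemma hasSum_mOne_of_quadratic {lam z M : ℝ} (hlam : 0 ≤ lam) (hz : 0 ≤ z) (hM : 0 ≤ M)
    (hzM : z * M ≤ 1) (hq : z * (lam + 2) < 1)
    (hquad : M = 1 + lam * z * M + z ^ 2 * M ^ 2) :
    HasSum (fun n : ℕ => mOne lam n * z ^ n) M := by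
  simp only [← motzkinFromCount_zero_left]
  rw [hasSum_iff_tendsto_nat_of_nonneg
    fun n => mul_nonneg (motzkinFromCount_nonneg hlam 0 n) (pow_nonneg hz n)]
  have hlim : Filter.Tendsto (fun N : ℕ => M * (z * (lam + 2)) ^ N) Filter.atTop (nhds 0) := by
    simpa using (tendsto_pow_atTop_nhds_zero_of_lt_one (by positivity) hq).const_mul M
  refine tendsto_iff_dist_tendsto_zero.2 (squeeze_zero (fun _ => dist_nonneg) (fun N => ?_) hlim)
  rw [dist_comm, Real.dist_eq]
  simpa using abs_sub_sum_motzkinFromCount_le hlam hz hM hzM hquad N 0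

theorem stmt9 (lam : ℝ) (hlam : 0 < lam) (z : ℝ) (hz0 : 0 < z)
    (hz1 : z < 1 / (lam + 2)) :
    HasSum (fun n : ℕ => mOne lam n * z ^ n)
      ((1 - lam * z - Real.sqrt ((1 - lam * z) ^ 2 - 4 * z ^ 2)) / (2 * z ^ 2)) := by
  have hq : z * (lam + 2) < 1 := (lt_div_iff₀ (by positivity)).1 hz1
  set s := Real.sqrt ((1 - lam * z) ^ 2 - 4 * z ^ 2) with hs
  have hs0 : 0 ≤ s := Real.sqrt_nonneg _
  have hsq : s ^ 2 = (1 - lam * z) ^ 2 - 4 * z ^ 2 := Real.sq_sqrt (by nlinarith)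
  have hle : s ≤ 1 - lam * z := Real.sqrt_le_iff.2 ⟨by nlinarith, by nlinarith⟩
  have hge : 1 - lam * z - 2 * z ≤ s := Real.le_sqrt_of_sq_le (by nlinarith)
  refine hasSum_mOne_of_quadratic hlam.le hz0.le (div_nonneg (by linarith) (by positivity))
    ?_ hq ?_
  · rw [← mul_div_assoc, div_le_one (by positivity)]
    nlinarith
  · field_simp
    linear_combination -hsq
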